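/- Let λ and x be real numbers and let n, r be nonnegative integers. Then ∑_{k=0}^{n} (k)_{r,λ} · x^k = ∑_{j=0}^{r} j! · {r brace j}_λ · ∑_{k=0}^{n} C(k, j) · x^k, where C(k,j) is the usual binomial coefficient. In particular, for x = 1 one has ∑_{k=0}^{n} (k)_{r,λ} = ∑_{j=0}^{r} j! · C(n+1, j+1) · {r brace j}_λ. -/

import Mathlib

/-- The degenerate falling factorial `(x)_{n,λ} = x(x-λ)⋯(x-(n-1)λ)`. -/
noncomputable def dff (lam x : ℝ) (n : ℕ) : ℝ := ∏ i ∈ Finset.range n, (x - i * lam)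

/-- The degenerate Stirling number of the second kind
`{n brace k}_λ = (1/k!) ∑_{j=0}^{k} C(k,j) (-1)^{k-j} (j)_{n,λ}`. -/
noncomputable def dstirling (lam : ℝ) (n k : ℕ) : ℝ :=
  (1 / (k.factorial : ℝ)) *
    ∑ j ∈ Finset.range (k + 1), (k.choose j : ℝ) * (-1) ^ (k - j) * dff lam (j : ℝ) n

/-- The generalized binomial coefficient `C(x,m) = x(x-1)⋯(x-m+1)/m!` with real upper argument. -/
noncomputable def gchoose (x : ℝ) (m : ℕ) : ℝ := (∏ i ∈ Finset.range m, (x - i)) / m.factorial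

/-- Generalized binomial coefficient with integer lower argument; zero when the lower
argument is negative. -/
noncomputable def gchooseZ (x : ℝ) (m : ℤ) : ℝ := if 0 ≤ m then gchoose x m.toNat else 0

open Polynomial in
theorem dff_eq_eval (lam : ℝ) (r : ℕ) :
    (fun x : ℝ ↦ dff lam x r) = (∏ i ∈ Finset.range r, (X - C (i * lam)) : ℝ[X]).eval := by
  ext x
  simp [dff, eval_prod]

theorem factorial_mul_dstirling (lam : ℝ) (r j : ℕ) :
    (j.factorial : ℝ) * dstirling lam r j = (fwdDiff 1)^[j] (fun x : ℝ ↦ dff lam x r) 0 := by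
  rw [fwdDiff_iter_eq_sum_shift, dstirling, ← mul_assoc,
    mul_one_div_cancel (Nat.cast_ne_zero.mpr j.factorial_ne_zero), one_mul]
  refine Finset.sum_congr rfl fun i _ ↦ ?_
  simp only [zsmul_eq_mul, zero_add, nsmul_eq_mul, mul_one]
  push_cast
  ring

theorem dstirling_eq_zero_of_lt (lam : ℝ) {r j : ℕ} (h : r < j) : dstirling lam r j = 0 := by
  have hfact : (j.factorial : ℝ) * dstirling lam r j = 0 := by
    rw [factorial_mul_dstirling, dff_eq_eval, Polynomial.fwdDiff_iter_eq_zero_of_degree_lt,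
      Pi.zero_apply]
    rwa [Polynomial.natDegree_finsetProd_X_sub_C_eq_card, Finset.card_range]
  exact (mul_eq_zero.mp hfact).resolve_left (Nat.cast_ne_zero.mpr j.factorial_ne_zero)

theorem dff_natCast_eq_sum_dstirling (lam : ℝ) (r k : ℕ) :
    dff lam (k : ℝ) r =
      ∑ j ∈ Finset.range (r + 1), (j.factorial : ℝ) * dstirling lam r j * (k.choose j : ℝ) := by
  have newton : dff lam (k : ℝ) r =
      ∑ j ∈ Finset.range (k + 1), (j.factorial : ℝ) * dstirling lam r j * (k.choose j : ℝ) := by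
    have h := shift_eq_sum_fwdDiff_iter (1 : ℝ) (fun x : ℝ ↦ dff lam x r) k 0
    simp_rw [factorial_mul_dstirling]
    simpa [mul_comm] using h
  rw [newton]
  rcases le_total k r with hkr | hrk
  · refine Finset.sum_subset (Finset.range_mono (by lia)) fun j _ hj ↦ ?_
    rw [Nat.choose_eq_zero_of_lt (by simpa using hj), Nat.cast_zero, mul_zero]
  · refine (Finset.sum_subset (Finset.range_mono (by lia)) fun j _ hj ↦ ?_).symm
    rw [dstirling_eq_zero_of_lt lam (by simpa using hj), mul_zero, zero_mul]

theorem sum_dff_mul_pow (lam x : ℝ) (n r : ℕ) :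
    ∑ k ∈ Finset.range (n + 1), dff lam (k : ℝ) r * x ^ k =
      ∑ j ∈ Finset.range (r + 1), (j.factorial : ℝ) * dstirling lam r j *
        ∑ k ∈ Finset.range (n + 1), (k.choose j : ℝ) * x ^ k := by
  simp_rw [dff_natCast_eq_sum_dstirling, Finset.sum_mul, Finset.mul_sum, mul_assoc]
  exact Finset.sum_comm

theorem sum_range_succ_choose (n j : ℕ) :
    ∑ k ∈ Finset.range (n + 1), k.choose j = (n + 1).choose (j + 1) := by
  rw [← Nat.sum_Icc_choose]
  refine (Finset.sum_subset (fun k hk ↦ ?_) fun k hk hkj ↦ ?_).symm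
  · simp only [Finset.mem_Icc, Finset.mem_range] at *
    lia
  · simp only [Finset.mem_Icc, Finset.mem_range] at *
    exact Nat.choose_eq_zero_of_lt (by lia)

theorem sum_dff_pow_eq (lam x : ℝ) (n r : ℕ) :
    (∑ k ∈ Finset.range (n + 1), dff lam (k : ℝ) r * x ^ k =
        ∑ j ∈ Finset.range (r + 1),
          (j.factorial : ℝ) * dstirling lam r j * ∑ k ∈ Finset.range (n + 1), (k.choose j : ℝ) * x ^ k) ∧
      (∑ k ∈ Finset.range (n + 1), dff lam (k : ℝ) r =
        ∑ j ∈ Finset.range (r + 1),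
          (j.factorial : ℝ) * ((n + 1).choose (j + 1) : ℝ) * dstirling lam r j) := by
  refine ⟨sum_dff_mul_pow lam x n r, ?_⟩
  have h := sum_dff_mul_pow lam 1 n r
  simp only [one_pow, mul_one] at h
  rw [h]
  refine Finset.sum_congr rfl fun j _ ↦ ?_
  rw [← sum_range_succ_choose, Nat.cast_sum, mul_right_comm]
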